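/- arXiv:math/0209196 — 2 statements merged into one kernel-verified Lean document; each statement's English description precedes it below -/
import Mathlib

section
/- Let S be a Noetherian ring and u, v ∈ S a regular sequence on S. For n ≥ 1, let A_n be the n × (n+1) bidiagonal matrix over S with (A_n)_{i,i} = u, (A_n)_{i,i+1} = v, and 0 elsewhere, and let M_n be the cokernel of the corresponding map S^{n+1} → S^n. Then ann_S M_n = (u,v)^n S. -/
/-- The `n × (n+1)` bidiagonal matrix with `u` on the main diagonal and `v` on the
superdiagonal. -/
def bidiagMatrix {S : Type} [CommRing S] (u v : S) (n : ℕ) :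
    Matrix (Fin n) (Fin (n + 1)) S :=
  Matrix.of fun i j =>
    if (j : ℕ) = (i : ℕ) then u else if (j : ℕ) = (i : ℕ) + 1 then v else 0

/-- The cokernel `M_n` of the map `S^{n+1} → S^n` given by the bidiagonal matrix `A_n`. -/
abbrev bidiagCoker {S : Type} [CommRing S] (u v : S) (n : ℕ) :=
  (Fin n → S) ⧸ LinearMap.range (Matrix.mulVecLin (bidiagMatrix u v n))

section

variable {S : Type} [CommRing S] {u v : S}

theorem bidiagMatrix_mulVec_apply (n : ℕ) (x : Fin (n + 1) → S) (k : Fin n) :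
    (bidiagMatrix u v n).mulVec x k = u * x k.castSucc + v * x k.succ := by
  have h (j : Fin (n + 1)) : bidiagMatrix u v n k j * x j =
      (if j = k.castSucc then u * x j else 0) + (if j = k.succ then v * x j else 0) := by
    simp only [bidiagMatrix, Matrix.of_apply, Fin.ext_iff, Fin.val_castSucc, Fin.val_succ]
    split_ifs <;> first | omega | simp
  simp only [Matrix.mulVec, dotProduct, h, Finset.sum_add_distrib]
  simp

/-- If `v` is a nonzerodivisor modulo `u`, then powers of `u` and `v` divide independently. -/
theorem pow_dvd_of_pow_dvd_pow_mul (hu : u ∈ nonZeroDivisors S)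
    (hv : ∀ x, u ∣ v * x → u ∣ x) (a b : ℕ) {x : S} (h : u ^ a ∣ v ^ b * x) : u ^ a ∣ x := by
  have dvd_of_dvd_pow_mul (b : ℕ) (y : S) (h : u ∣ v ^ b * y) : u ∣ y := by
    induction b with
    | zero => simpa using h
    | succ b ih => exact ih (hv _ (by rwa [← mul_assoc, ← pow_succ']))
  induction a with
  | zero => simp
  | succ a ih =>
    obtain ⟨y, rfl⟩ := ih ((pow_dvd_pow u a.le_succ).trans h)
    obtain ⟨c, hc⟩ := h
    have hy : v ^ b * y = u * c := by
      rw [← mul_cancel_left_mem_nonZeroDivisors (pow_mem hu a)]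
      linear_combination hc
    rw [pow_succ]
    exact mul_dvd_mul_left _ (dvd_of_dvd_pow_mul b y ⟨c, hy⟩)

theorem pow_mul_pow_mem_span_pair_pow {a b n : ℕ} (h : a + b = n) :
    u ^ a * v ^ b ∈ Ideal.span {u, v} ^ n := by
  rw [← h, pow_add]
  exact Ideal.mul_mem_mul (Ideal.pow_mem_pow (Ideal.subset_span (by simp)) a)
    (Ideal.pow_mem_pow (Ideal.subset_span (by simp)) b)

open scoped Pointwise in
theorem span_pair_pow_le {n : ℕ} {I : Ideal S}
    (h : ∀ a b, a + b = n → u ^ a * v ^ b ∈ I) : Ideal.span {u, v} ^ n ≤ I := by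
  have mem_pow (n : ℕ) : ∀ x ∈ ({u, v} : Set S) ^ n, ∃ a b, a + b = n ∧ x = u ^ a * v ^ b := by
    induction n with
    | zero => exact fun x hx => ⟨0, 0, rfl, by simpa using hx⟩
    | succ n ih =>
      intro x hx
      rw [pow_succ] at hx
      obtain ⟨y, hy, z, hz, rfl⟩ := Set.mem_mul.mp hx
      obtain ⟨a, b, hab, rfl⟩ := ih y hy
      obtain rfl | rfl := hz
      · exact ⟨a + 1, b, by omega, by ring⟩
      · exact ⟨a, b + 1, by omega, by ring⟩
  rw [Ideal.span, Submodule.span_pow, Submodule.span_le]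
  intro x hx
  obtain ⟨a, b, hab, rfl⟩ := mem_pow n x hx
  exact h a b hab

/-- The ideals `(u ^ (i + 1), v ^ (n - i))` for `i < n` intersect inside `(u, v) ^ n`. -/
theorem mem_span_pair_pow_of_forall_eq_add (hu : u ∈ nonZeroDivisors S)
    (hv : ∀ x, u ∣ v * x → u ∣ x) {n : ℕ} {s : S}
    (h : ∀ i < n, ∃ a b, s = u ^ (i + 1) * a + v ^ (n - i) * b) :
    s ∈ Ideal.span {u, v} ^ n := by
  have key (m : ℕ) (hm : m ≤ n) : ∃ t c, s = v ^ (n - m) * t + u ^ m * c ∧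
      v ^ (n - m) * t ∈ Ideal.span {u, v} ^ n := by
    induction m with
    | zero => exact ⟨0, s, by simp, by simp⟩
    | succ m ih =>
      obtain ⟨t, c, hs, ht⟩ := ih (by omega)
      obtain ⟨a, b, hab⟩ := h m (by omega)
      obtain ⟨d, hd⟩ : u ^ m ∣ b - t :=
        pow_dvd_of_pow_dvd_pow_mul hu hv m (n - m) ⟨c - u * a, by linear_combination hs - hab⟩
      have hpow : v ^ (n - m) = v ^ (n - (m + 1)) * v := by
        rw [← pow_succ]
        congr 1
        omega
      refine ⟨v * (t + u ^ m * d), a, ?_, ?_⟩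
      · rw [← mul_assoc, ← hpow]
        linear_combination hab + v ^ (n - m) * hd
      · rw [← mul_assoc, ← hpow, mul_add, ← mul_assoc, mul_comm _ (u ^ m)]
        exact add_mem ht (Ideal.mul_mem_right _ _ (pow_mul_pow_mem_span_pair_pow (by omega)))
  obtain ⟨t, c, hs, ht⟩ := key n le_rfl
  rw [hs]
  refine add_mem ht (Ideal.mul_mem_right _ _ ?_)
  simpa using pow_mul_pow_mem_span_pair_pow (u := u) (v := v) (add_zero n)

/-- In a chain `u • f 0 = 0`, `v • f k = -u • f (k + 1)` that vanishes from `n` on, all monomials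
of degree `n` in `u` and `v` act as zero. -/
theorem pow_mul_pow_smul_eq_zero {M : Type*} [AddCommGroup M] [Module S M] {f : ℕ → M} {n : ℕ}
    (hzero : u • f 0 = 0) (hsucc : ∀ k, v • f k + u • f (k + 1) = 0)
    (hlarge : ∀ k, n ≤ k → f k = 0) {a b : ℕ} (hab : a + b = n) (k : ℕ) :
    (u ^ a * v ^ b) • f k = 0 := by
  have u_pow (k : ℕ) : u ^ (k + 1) • f k = 0 := by
    induction k with
    | zero => simpa using hzero
    | succ k ih =>
      rw [pow_succ, mul_smul, eq_neg_of_add_eq_zero_right (hsucc k), smul_neg, smul_comm, ih,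
        smul_zero, neg_zero]
  have v_pow (b : ℕ) : ∀ k, n ≤ k + b → v ^ b • f k = 0 := by
    induction b with
    | zero => exact fun k hk => by rw [hlarge k hk, smul_zero]
    | succ b ih =>
      intro k hk
      rw [pow_succ, mul_smul, eq_neg_of_add_eq_zero_left (hsucc k), smul_neg, smul_comm,
        ih (k + 1) (by omega), smul_zero, neg_zero]
  obtain hk | hk := Nat.lt_or_ge k a
  · obtain ⟨c, rfl⟩ := Nat.exists_eq_add_of_le' hk
    rw [pow_add, mul_right_comm, mul_smul, u_pow, smul_zero]
  · rw [mul_smul, v_pow b k (by omega), smul_zero]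

theorem span_pair_pow_le_annihilator_bidiagCoker (n : ℕ) :
    Ideal.span {u, v} ^ n ≤ Module.annihilator S (bidiagCoker u v n) := by
  let e (k : ℕ) : Fin n → S := fun i => if (i : ℕ) = k then 1 else 0
  let f (k : ℕ) : bidiagCoker u v n := Submodule.Quotient.mk (e k)
  have hzero : u • f 0 = 0 := by
    rw [← Submodule.Quotient.mk_smul, Submodule.Quotient.mk_eq_zero]
    refine ⟨fun j => if (j : ℕ) = 0 then 1 else 0, ?_⟩
    ext i
    simp [bidiagMatrix_mulVec_apply, e, -Fin.val_eq_zero_iff]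
  have hsucc (k : ℕ) : v • f k + u • f (k + 1) = 0 := by
    rw [← Submodule.Quotient.mk_smul, ← Submodule.Quotient.mk_smul, ← Submodule.Quotient.mk_add,
      Submodule.Quotient.mk_eq_zero]
    refine ⟨fun j => if (j : ℕ) = k + 1 then 1 else 0, ?_⟩
    ext i
    simp [bidiagMatrix_mulVec_apply, e, add_comm]
  have hlarge (k : ℕ) (hk : n ≤ k) : f k = 0 := by
    have : e k = 0 := by
      ext i
      exact if_neg (by omega)
    simp [f, this]
  refine span_pair_pow_le fun a b hab => ?_
  rw [Module.mem_annihilator]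
  intro m
  obtain ⟨x, rfl⟩ := Submodule.Quotient.mk_surjective _ m
  have hx : (Submodule.Quotient.mk x : bidiagCoker u v n) = ∑ i : Fin n, x i • f i := by
    have : x = ∑ i : Fin n, x i • e i := by
      ext j
      simp [e, Fin.val_inj]
    conv_lhs => rw [this]
    exact map_sum (Submodule.mkQ _) _ _
  rw [hx, Finset.smul_sum]
  refine Finset.sum_eq_zero fun i _ => ?_
  rw [smul_comm, pow_mul_pow_smul_eq_zero hzero hsucc hlarge hab, smul_zero]

theorem exists_eq_add_of_mem_annihilator_bidiagCoker (hu : u ∈ nonZeroDivisors S)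
    (hv : ∀ x, u ∣ v * x → u ∣ x) {n : ℕ} {s : S}
    (hs : s ∈ Module.annihilator S (bidiagCoker u v n)) (i : ℕ) (hi : i < n) :
    ∃ a b, s = u ^ (i + 1) * a + v ^ (n - i) * b := by
  rw [Module.mem_annihilator] at hs
  have hmem := hs (Submodule.Quotient.mk (Pi.single ⟨i, hi⟩ 1))
  rw [← Submodule.Quotient.mk_smul, Submodule.Quotient.mk_eq_zero] at hmem
  obtain ⟨x, hx⟩ := hmem
  have row (k : ℕ) (hk : k < n) :
      u * x ⟨k, by omega⟩ + v * x ⟨k + 1, by omega⟩ = if k = i then s else 0 := by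
    have := congrFun hx ⟨k, hk⟩
    simpa [bidiagMatrix_mulVec_apply, Pi.single_apply] using this
  have left (k : ℕ) (hk : k ≤ i) : u ^ k ∣ x ⟨k, by omega⟩ := by
    induction k with
    | zero => simp
    | succ k ih =>
      obtain ⟨y, hy⟩ := ih (by omega)
      have hrow := row k (by omega)
      rw [if_neg (by omega)] at hrow
      refine pow_dvd_of_pow_dvd_pow_mul hu hv (k + 1) 1 ⟨-y, ?_⟩
      linear_combination hrow - u * hy
  have right (k : ℕ) (hk : i + 1 + k ≤ n) : v ^ k ∣ x ⟨n - k, by omega⟩ := by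
    induction k with
    | zero => simp
    | succ k ih =>
      obtain ⟨y, hy⟩ := ih (by omega)
      have hrow := row (n - (k + 1)) (by omega)
      have hindex : n - (k + 1) + 1 = n - k := by omega
      simp only [hindex] at hrow
      rw [if_neg (by omega), hy] at hrow
      obtain ⟨z, rfl⟩ : u ∣ y := by
        simpa using pow_dvd_of_pow_dvd_pow_mul hu hv 1 (k + 1) (x := y)
          ⟨-x ⟨n - (k + 1), by omega⟩, by linear_combination hrow⟩
      refine ⟨-z, ?_⟩
      rw [← mul_cancel_left_mem_nonZeroDivisors hu]
      linear_combination hrow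
  obtain ⟨a, ha⟩ := left i le_rfl
  obtain ⟨b, hb⟩ := right (n - (i + 1)) (by omega)
  have hindex : n - (n - (i + 1)) = i + 1 := by omega
  simp only [hindex] at hb
  have hpow : v ^ (n - i) = v ^ (n - (i + 1)) * v := by
    rw [← pow_succ]
    congr 1
    omega
  have hrow := row i hi
  rw [if_pos rfl, ha, hb] at hrow
  refine ⟨a, b, ?_⟩
  rw [hpow]
  linear_combination -hrow

end

/-- Let `S` be a Noetherian ring and `u, v` a regular sequence on `S` (that is, `u` is a
nonzerodivisor on `S`, `v` is a nonzerodivisor on `S/uS`, and `(u,v)S ≠ S`).  For `n ≥ 1`,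
the annihilator of the cokernel `M_n` of the bidiagonal matrix `A_n` is `(u,v)ⁿ`. -/
theorem annihilator_bidiagCoker_eq_pow
    {S : Type} [CommRing S] [IsNoetherianRing S] (u v : S)
    (hu : u ∈ nonZeroDivisors S)
    (hv : Ideal.Quotient.mk (Ideal.span {u}) v ∈ nonZeroDivisors (S ⧸ Ideal.span {u}))
    (huv : Ideal.span {u, v} ≠ ⊤)
    (n : ℕ) (hn : 1 ≤ n) :
    Module.annihilator S (bidiagCoker u v n) = (Ideal.span {u, v}) ^ n := by
  have hdvd (x : S) (hx : u ∣ v * x) : u ∣ x := by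
    rw [← Ideal.mem_span_singleton, ← Ideal.Quotient.eq_zero_iff_mem] at hx ⊢
    rw [map_mul, mul_comm] at hx
    exact (mul_right_mem_nonZeroDivisors_eq_zero_iff hv).mp hx
  refine le_antisymm (fun s hs => ?_) (span_pair_pow_le_annihilator_bidiagCoker n)
  exact mem_span_pair_pow_of_forall_eq_add hu hdvd
    (exists_eq_add_of_mem_annihilator_bidiagCoker hu hdvd hs)
end

section
/- Let k be a field, R = k[[u,v]][x,y], I = (x,y)R, P = (u,v,x,y)R, and f = ux + vy. Then Hom_R(R/P, H^2_I(R/fR)) is an infinite dimensional k-vector space; in particular it is not a finitely generated R-module. -/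
set_option maxHeartbeats 800000

open MvPolynomial

universe u v w w'

section Koszul

open CategoryTheory Limits

namespace ChainComplex

variable {D : Type w} [Category.{w'} D] [Abelian D] {n : ℕ}

/-- The inclusion of the homology in degree `n + 1` of a complex whose differential into that
degree vanishes. -/
noncomputable def homologyToTop (K : ChainComplex D ℕ) (h : K.d (n + 2) (n + 1) = 0) :
    K.homology (n + 1) ⟶ K.X (n + 1) :=
  K.homologyι (n + 1) ≫ (K.pOpcyclesIso (n + 2) (n + 1) (by simp) h).inv

lemma homologyToTop_comp_d (K : ChainComplex D ℕ) (h : K.d (n + 2) (n + 1) = 0) :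
    K.homologyToTop h ≫ K.d (n + 1) n = 0 := by
  rw [← K.p_fromOpcycles (n + 1) n, ← K.pOpcyclesIso_hom (n + 2) (n + 1) (by simp) h,
    homologyToTop, Category.assoc, Iso.inv_hom_id_assoc, K.homologyι_comp_fromOpcycles]

lemma homologyToTop_exact (K : ChainComplex D ℕ) (h : K.d (n + 2) (n + 1) = 0) :
    (ShortComplex.mk _ _ (K.homologyToTop_comp_d h)).Exact := by
  let e := K.pOpcyclesIso (n + 2) (n + 1) (by simp) h
  have hK : (ShortComplex.mk _ _ (K.homologyι_comp_fromOpcycles (n + 1) n)).Exact :=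
    ShortComplex.exact_of_f_is_kernel _ (K.homologyIsKernel (n + 1) n (by simp))
  refine ShortComplex.exact_of_iso ?_ hK
  refine ShortComplex.isoMk (Iso.refl _) e.symm (Iso.refl _) ?_ ?_
  · simp [homologyToTop, e]
  · rw [← cancel_epi e.hom]
    simp [e]

lemma homologyToTop_naturality {K L : ChainComplex D ℕ} (φ : K ⟶ L)
    (hK : K.d (n + 2) (n + 1) = 0) (hL : L.d (n + 2) (n + 1) = 0) :
    HomologicalComplex.homologyMap φ (n + 1) ≫ L.homologyToTop hL =
      K.homologyToTop hK ≫ φ.f (n + 1) := by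
  simp only [homologyToTop, Category.assoc, HomologicalComplex.homologyι_naturality_assoc]
  congr 1
  rw [Iso.comp_inv_eq, Category.assoc, Iso.eq_inv_comp]
  exact HomologicalComplex.p_opcyclesMap _ _

end ChainComplex

namespace CategoryTheory.ProjectiveResolution

section LeftDerived

variable {C : Type u} [Category.{v} C] [Abelian C] {D : Type w} [Category.{w'} D]
  [Abelian D] (F : C ⥤ D) [F.Additive] {n : ℕ}

lemma map_d_eq_zero {X : C} (P : ProjectiveResolution X) (hP : IsZero (P.complex.X (n + 2))) :
    ((F.mapHomologicalComplex _).obj P.complex).d (n + 2) (n + 1) = 0 :=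
  (F.map_isZero hP).eq_of_src _ _

variable [EnoughProjectives C]

/-- A variant of `isoLeftDerivedObj` whose target is spelled as a homology object. -/
noncomputable def isoLeftDerivedHomology {X : C} (P : ProjectiveResolution X) (n : ℕ) :
    (F.leftDerived n).obj X ≅
      ((F.mapHomologicalComplex (ComplexShape.down ℕ)).obj P.complex).homology n :=
  P.isoLeftDerivedObj F n

lemma isoLeftDerivedHomology_hom_naturality {X Y : C} (f : X ⟶ Y) (P : ProjectiveResolution X)
    (Q : ProjectiveResolution Y) (φ : P.complex ⟶ Q.complex)
    (comm : φ.f 0 ≫ Q.π.f 0 = P.π.f 0 ≫ f) (n : ℕ) :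
    (F.leftDerived n).map f ≫ (Q.isoLeftDerivedHomology F n).hom =
      (P.isoLeftDerivedHomology F n).hom ≫
        HomologicalComplex.homologyMap ((F.mapHomologicalComplex _).map φ) n :=
  isoLeftDerivedObj_hom_naturality f P Q φ comm F n

/-- If `P` vanishes in degree `n + 2`, `L_{n+1} F` maps to `F P_{n+1}` as the kernel of the
differential. -/
noncomputable def leftDerivedToTop {X : C} (P : ProjectiveResolution X)
    (hP : IsZero (P.complex.X (n + 2))) :
    (F.leftDerived (n + 1)).obj X ⟶ F.obj (P.complex.X (n + 1)) :=
  (P.isoLeftDerivedHomology F (n + 1)).hom ≫ ChainComplex.homologyToTop _ (P.map_d_eq_zero F hP)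

variable {F}

lemma leftDerivedToTop_comp_map_d {X : C} (P : ProjectiveResolution X)
    (hP : IsZero (P.complex.X (n + 2))) :
    P.leftDerivedToTop F hP ≫ F.map (P.complex.d (n + 1) n) = 0 :=
  (Category.assoc _ _ _).trans ((congrArg ((P.isoLeftDerivedHomology F (n + 1)).hom ≫ ·)
    (ChainComplex.homologyToTop_comp_d _ (P.map_d_eq_zero F hP))).trans comp_zero)

lemma leftDerivedToTop_exact {X : C} (P : ProjectiveResolution X)
    (hP : IsZero (P.complex.X (n + 2))) :
    (ShortComplex.mk _ _ (P.leftDerivedToTop_comp_map_d (F := F) hP)).Exact := by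
  refine ShortComplex.exact_of_iso ?_
    (ChainComplex.homologyToTop_exact _ (P.map_d_eq_zero F hP))
  refine ShortComplex.isoMk (P.isoLeftDerivedHomology F (n + 1)).symm (Iso.refl _)
    (Iso.refl _) ?_ ?_
  · exact (Iso.inv_hom_id_assoc _ _).trans (Category.comp_id _).symm
  · exact (Category.id_comp _).trans (Category.comp_id _).symm

lemma leftDerivedToTop_naturality {X Y : C} (f : X ⟶ Y) (P : ProjectiveResolution X)
    (Q : ProjectiveResolution Y) (φ : P.complex ⟶ Q.complex)
    (comm : φ.f 0 ≫ Q.π.f 0 = P.π.f 0 ≫ f)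
    (hP : IsZero (P.complex.X (n + 2))) (hQ : IsZero (Q.complex.X (n + 2))) :
    (F.leftDerived (n + 1)).map f ≫ Q.leftDerivedToTop F hQ =
      P.leftDerivedToTop F hP ≫ F.map (φ.f (n + 1)) := by
  have h := ChainComplex.homologyToTop_naturality ((F.mapHomologicalComplex _).map φ)
    (P.map_d_eq_zero F hP) (Q.map_d_eq_zero F hQ)
  have h' := isoLeftDerivedHomology_hom_naturality F f P Q φ comm (n + 1)
  calc
    _ = ((F.leftDerived (n + 1)).map f ≫ (Q.isoLeftDerivedHomology F (n + 1)).hom) ≫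
        ChainComplex.homologyToTop _ (Q.map_d_eq_zero F hQ) := (Category.assoc _ _ _).symm
    _ = (P.isoLeftDerivedHomology F (n + 1)).hom ≫
        ChainComplex.homologyToTop _ (P.map_d_eq_zero F hP) ≫
          ((F.mapHomologicalComplex _).map φ).f (n + 1) := by
      rw [h', Category.assoc, h]
    _ = _ := (Category.assoc _ _ _).symm

end LeftDerived

section Ext

variable {R : Type w} [Ring R] {C : Type u} [Category.{v} C] [Abelian C] [Linear R C]
  [EnoughProjectives C] {n : ℕ}

/-- If `P` vanishes in degree `n + 2`, every morphism `P_{n+1} ⟶ Y` is a cocycle and has a class in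
`Ext^{n+1}(X, Y)`. -/
noncomputable def topToExt {X : C} (P : ProjectiveResolution X)
    (hP : IsZero (P.complex.X (n + 2))) (Y : C) :
    ModuleCat.of R (P.complex.X (n + 1) ⟶ Y) ⟶ ((Ext R C (n + 1)).obj (Opposite.op X)).obj Y :=
  (P.leftDerivedToTop ((linearYoneda R C).obj Y).rightOp hP).unop

lemma topToExt_eq_zero_iff {X : C} (P : ProjectiveResolution X)
    (hP : IsZero (P.complex.X (n + 2))) (Y : C) (g : P.complex.X (n + 1) ⟶ Y) :
    P.topToExt (R := R) hP Y g = 0 ↔ ∃ h, P.complex.d (n + 1) n ≫ h = g := by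
  have h := (P.leftDerivedToTop_exact (F := ((linearYoneda R C).obj Y).rightOp) hP).unop
  have h0 := (ShortComplex.mk _ _
    (P.leftDerivedToTop_comp_map_d (F := ((linearYoneda R C).obj Y).rightOp) hP)).unop.zero
  constructor
  · exact (ShortComplex.moduleCat_exact_iff _).1 h g
  · rintro ⟨h, rfl⟩
    exact ConcreteCategory.congr_hom h0 h

lemma topToExt_naturality {X Y : C} (f : X ⟶ Y) (P : ProjectiveResolution X)
    (Q : ProjectiveResolution Y) (φ : P.complex ⟶ Q.complex)
    (comm : φ.f 0 ≫ Q.π.f 0 = P.π.f 0 ≫ f)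
    (hP : IsZero (P.complex.X (n + 2))) (hQ : IsZero (Q.complex.X (n + 2))) (Z : C)
    (g : Q.complex.X (n + 1) ⟶ Z) :
    ((Ext R C (n + 1)).map f.op).app Z (Q.topToExt (R := R) hQ Z g) =
      P.topToExt (R := R) hP Z (φ.f (n + 1) ≫ g) :=
  ConcreteCategory.congr_hom (congrArg Quiver.Hom.unop (leftDerivedToTop_naturality
    (F := ((linearYoneda R C).obj Z).rightOp) f P Q φ comm hP hQ)) g

end Ext

end CategoryTheory.ProjectiveResolution

namespace Koszul

variable {R : Type u} [CommRing R]

/-- The modules of the Koszul complex on two elements. -/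
noncomputable def X (R : Type u) [CommRing R] : ℕ → ModuleCat.{u} R
  | 0 => ModuleCat.of R R
  | 1 => ModuleCat.of R (R × R)
  | 2 => ModuleCat.of R R
  | _ + 3 => ModuleCat.of R PUnit

/-- The differentials of the Koszul complex on `a` and `b`. -/
noncomputable def d (a b : R) : ∀ n, X R (n + 1) ⟶ X R n
  | 0 => ModuleCat.ofHom ((LinearMap.mulLeft R a).coprod (LinearMap.mulLeft R b))
  | 1 => ModuleCat.ofHom ((LinearMap.mulLeft R b).prod (-LinearMap.mulLeft R a))
  | _ + 2 => 0

lemma d_comp_d (a b : R) : ∀ n, d a b (n + 1) ≫ d a b n = 0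
  | 0 => by
    refine ModuleCat.hom_ext (LinearMap.ext fun (r : R) => ?_)
    change a * (b * r) + b * (-(a * r)) = 0
    ring
  | _ + 1 => zero_comp

/-- The Koszul complex on two elements. -/
noncomputable def complex (a b : R) : ChainComplex (ModuleCat.{u} R) ℕ :=
  ChainComplex.of (X R) (d a b) (d_comp_d a b)

lemma complex_d (a b : R) (n : ℕ) : (complex a b).d (n + 1) n = d a b n :=
  ChainComplex.of_d _ _ n

instance (n : ℕ) : Projective (X R n) := by
  rcases n with _ | _ | _ | n
  · exact ModuleCat.projective_of_categoryTheory_projective (ModuleCat.of R R)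
  · exact ModuleCat.projective_of_categoryTheory_projective (ModuleCat.of R (R × R))
  · exact ModuleCat.projective_of_categoryTheory_projective (ModuleCat.of R R)
  · exact ModuleCat.projective_of_categoryTheory_projective (ModuleCat.of R PUnit.{u + 1})

lemma isZero_X (n : ℕ) : IsZero (X R (n + 3)) :=
  ModuleCat.isZero_of_subsingleton (ModuleCat.of R PUnit.{u + 1})

/-- The augmentation of the Koszul complex. -/
noncomputable def augmentation (a b : R) :
    X R 0 ⟶ ModuleCat.of R (R ⧸ Ideal.span {a, b}) :=
  ModuleCat.ofHom (Submodule.mkQ (Ideal.span {a, b}))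

lemma augmentation_eq_zero_iff (a b r : R) :
    augmentation a b r = 0 ↔ r ∈ Ideal.span {a, b} :=
  Submodule.Quotient.mk_eq_zero (Ideal.span {a, b})

lemma d_comp_augmentation (a b : R) : d a b 0 ≫ augmentation a b = 0 := by
  refine ModuleCat.hom_ext (LinearMap.ext fun (r : R × R) => ?_)
  exact (augmentation_eq_zero_iff a b _).2
    (Ideal.mem_span_pair.2 ⟨r.1, r.2, by change _ = a * r.1 + b * r.2; ring⟩)

/-- The regularity condition making the Koszul complex on `a` and `b` exact. -/
structure Regular (a b : R) : Prop where
  eq_zero : ∀ r, a * r = 0 → r = 0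
  dvd : ∀ r, a ∣ b * r → a ∣ r

lemma exact_zero (a b : R) : (ShortComplex.mk _ _ (d_comp_augmentation a b)).Exact := by
  rw [ShortComplex.moduleCat_exact_iff]
  intro r hr
  obtain ⟨p, q, h⟩ := Ideal.mem_span_pair.1 ((augmentation_eq_zero_iff a b r).1 hr)
  refine ⟨((p, q) : R × R), ?_⟩
  change a * p + b * q = r
  rw [← h]
  ring

lemma exact_succ {a b : R} (h : Regular a b) (n : ℕ) :
    (ShortComplex.mk _ _ (d_comp_d a b n)).Exact := by
  rw [ShortComplex.moduleCat_exact_iff]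
  rcases n with _ | _ | n
  · rintro ⟨p, q⟩ hpq
    change a * p + b * q = 0 at hpq
    obtain ⟨r, rfl⟩ := h.dvd q ⟨-p, by linear_combination hpq⟩
    refine ⟨(-r : R), Prod.ext ?_ ?_⟩
    · change b * -r = p
      refine (sub_eq_zero.1 (h.eq_zero _ ?_)).symm
      linear_combination hpq
    · change -(a * -r) = a * r
      ring
  · intro (r : R) hr
    have : a * r = 0 := by
      have := congrArg Prod.snd (show ((b * r, -(a * r)) : R × R) = 0 from hr)
      simpa using this
    exact ⟨0, (h.eq_zero r this).symm ▸ map_zero _⟩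
  · intro r _
    exact ⟨0, Subsingleton.elim (α := PUnit) _ _⟩

/-- The Koszul complex on a regular pair is a projective resolution. -/
noncomputable def resolution {a b : R} (h : Regular a b) :
    ProjectiveResolution (ModuleCat.of R (R ⧸ Ideal.span {a, b})) where
  complex := complex a b
  projective n := inferInstanceAs (Projective (X R n))
  π := (ChainComplex.toSingle₀Equiv _ _).symm ⟨augmentation a b, by
    rw [complex_d]; exact d_comp_augmentation a b⟩
  quasiIso := ⟨fun n => by
    cases n
    · rw [ChainComplex.quasiIsoAt₀_iff, ShortComplex.quasiIso_iff_of_zeros']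
      · refine (ShortComplex.exact_and_epi_g_iff_of_iso ?_).2
          ⟨exact_zero a b, (ModuleCat.epi_iff_surjective _).2
            (Submodule.mkQ_surjective (Ideal.span {a, b}))⟩
        refine ShortComplex.isoMk (Iso.refl _) (Iso.refl _) (Iso.refl _) ?_ ?_
        · refine (Category.id_comp _).trans (Eq.trans ?_ (Category.comp_id _).symm)
          exact (complex_d a b 0).symm
        · refine (Category.id_comp _).trans (Eq.trans ?_ (Category.comp_id _).symm)
          exact (ChainComplex.toSingle₀Equiv_symm_apply_f_zero (C := complex a b)
            (augmentation a b) _).symm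
      all_goals rfl
    · rename_i n
      rw [quasiIsoAt_iff_exactAt']
      · rw [HomologicalComplex.exactAt_iff' _ (n + 1 + 1) (n + 1) n (by simp) (by simp)]
        refine ShortComplex.exact_of_iso ?_ (exact_succ h n)
        refine ShortComplex.isoMk (Iso.refl _) (Iso.refl _) (Iso.refl _) ?_ ?_
        · refine (Category.id_comp _).trans (Eq.trans ?_ (Category.comp_id _).symm)
          exact complex_d a b (n + 1)
        · refine (Category.id_comp _).trans (Eq.trans ?_ (Category.comp_id _).symm)
          exact complex_d a b n
      · apply ChainComplex.exactAt_succ_single_obj⟩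

lemma resolution_π_f_zero {a b : R} (h : Regular a b) :
    (resolution h).π.f 0 = augmentation a b :=
  ChainComplex.toSingle₀Equiv_symm_apply_f_zero _ _

/-- The components of the comparison map between Koszul complexes. -/
noncomputable def mapComponent (c e : R) : ∀ n, X R n ⟶ X R n
  | 0 => 𝟙 _
  | 1 => ModuleCat.ofHom ((LinearMap.mulLeft R c).prodMap (LinearMap.mulLeft R e))
  | 2 => ModuleCat.ofHom (LinearMap.mulLeft R (c * e))
  | _ + 3 => 0

lemma mapComponent_comm (a b c e : R) : ∀ n,
    mapComponent c e (n + 1) ≫ d a b n = d (a * c) (b * e) n ≫ mapComponent c e n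
  | 0 => by
    refine ModuleCat.hom_ext (LinearMap.ext fun (r : R × R) => ?_)
    change a * (c * r.1) + b * (e * r.2) = a * c * r.1 + b * e * r.2
    ring
  | 1 => by
    refine ModuleCat.hom_ext (LinearMap.ext fun (r : R) => ?_)
    change ((b * (c * e * r), -(a * (c * e * r))) : R × R) =
      (c * (b * e * r), e * (-(a * c * r)))
    ext <;> ring
  | _ + 2 => comp_zero.trans zero_comp.symm

/-- The comparison map from the Koszul complex on `a * c`, `b * e` to that on `a`, `b`. -/
noncomputable def map (a b c e : R) : complex (a * c) (b * e) ⟶ complex a b :=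
  ChainComplex.ofHom (mapComponent c e) fun n => by
    rw [complex_d, complex_d]
    exact mapComponent_comm a b c e n

variable {M : ModuleCat.{u} R}

/-- The class in `Ext²(R/(a,b), M)` attached to an element of `M` by the Koszul resolution. -/
noncomputable def toExt {a b : R} (h : Regular a b) (M : ModuleCat.{u} R) :
    M →ₗ[R] ((Ext R (ModuleCat.{u} R) 2).obj
      (Opposite.op (ModuleCat.of R (R ⧸ Ideal.span {a, b})))).obj M :=
  ((resolution h).topToExt (n := 1) (isZero_X 0) M).hom ∘ₗ
    (ModuleCat.homLinearEquiv (S := R)).symm.toLinearMap ∘ₗ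
      (LinearMap.ringLmapEquivSelf R R M).symm.toLinearMap

lemma toExt_apply {a b : R} (h : Regular a b) (m : M) :
    toExt h M m = (resolution h).topToExt (R := R) (n := 1) (isZero_X 0) M
      (ModuleCat.ofHom (LinearMap.toSpanSingleton R M m)) :=
  rfl

lemma toExt_eq_zero_iff {a b : R} (h : Regular a b) (m : M) :
    toExt h M m = 0 ↔ ∃ p q : M, m = a • p + b • q := by
  rw [toExt_apply]
  refine (ProjectiveResolution.topToExt_eq_zero_iff _ _ _ _).trans ⟨?_, ?_⟩
  · rintro ⟨g, hg⟩
    have h1 : (complex a b).d 2 1 = _ := complex_d a b 1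
    let g' : (R × R) →ₗ[R] M := g.hom
    have h2 : g' (b * 1, -(a * 1)) = (1 : R) • m := by
      have := ConcreteCategory.congr_hom hg (1 : R)
      change g' ((complex a b).d 2 1 (1 : R)) = _ at this
      rw [h1] at this
      exact this
    refine ⟨-g' (0, 1), g' (1, 0), ?_⟩
    rw [one_smul] at h2
    rw [← h2, smul_neg, ← map_smul, ← map_smul, ← map_neg, ← map_add]
    simp
  · rintro ⟨p, q, rfl⟩
    refine ⟨ModuleCat.ofHom ((LinearMap.toSpanSingleton R M q).coprod
      (-LinearMap.toSpanSingleton R M p)), ?_⟩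
    have h1 : (resolution h).complex.d 2 1 = _ := complex_d a b 1
    refine (congrArg (· ≫ _) h1).trans ?_
    refine ModuleCat.hom_ext (LinearMap.ext fun (r : R) => ?_)
    change (b * r) • q + -((-(a * r)) • p) = r • (a • p + b • q)
    module

lemma toExt_naturality {a b c e : R} (h : Regular a b) (h' : Regular (a * c) (b * e))
    (f : ModuleCat.of R (R ⧸ Ideal.span {a * c, b * e}) ⟶
      ModuleCat.of R (R ⧸ Ideal.span {a, b}))
    (hf : augmentation (a * c) (b * e) ≫ f = augmentation a b) (m : M) :
    ((Ext R (ModuleCat.{u} R) 2).map f.op).app M (toExt h M m) = toExt h' M ((c * e) • m) := by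
  rw [toExt_apply, toExt_apply]
  refine (ProjectiveResolution.topToExt_naturality (n := 1) f (resolution h') (resolution h)
    (map a b c e) ?_ (isZero_X 0) (isZero_X 0) M _).trans ?_
  · rw [resolution_π_f_zero, resolution_π_f_zero]
    exact (Category.id_comp _).trans hf.symm
  · congr 1
    refine ModuleCat.hom_ext (LinearMap.ext fun (r : R) => ?_)
    change (c * e * r) • m = r • ((c * e) • m)
    module

end Koszul

namespace localCohomology

variable {R : Type u} [CommRing R]

/-- The map `Ext²(R/J', M) ⟶ Ext²(R/J, M)` induced by an inclusion of ideals. -/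
noncomputable def extMap {J J' : Ideal R} (h : J ≤ J') (M : ModuleCat.{u} R) :
    ((Ext R (ModuleCat.{u} R) 2).obj (Opposite.op (ModuleCat.of R (R ⧸ J')))).obj M ⟶
      ((Ext R (ModuleCat.{u} R) 2).obj (Opposite.op (ModuleCat.of R (R ⧸ J)))).obj M :=
  ((Ext R (ModuleCat.{u} R) 2).map
    (ModuleCat.ofHom (Submodule.mapQ J J' LinearMap.id h)).op).app M

lemma extMap_extMap {J J' J'' : Ideal R} (h : J ≤ J') (h' : J' ≤ J'') (M : ModuleCat.{u} R)
    (e) : extMap h M (extMap h' M e) = extMap (h.trans h') M e := by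
  have h1 : ModuleCat.ofHom (Submodule.mapQ J J' LinearMap.id h) ≫
      ModuleCat.ofHom (Submodule.mapQ J' J'' LinearMap.id h') =
      ModuleCat.ofHom (Submodule.mapQ J J'' LinearMap.id (h.trans h')) := by
    ext
    rfl
  have h2 : extMap h' M ≫ extMap h M = extMap (h.trans h') M := by
    rw [extMap, extMap, extMap, ← h1, op_comp, Functor.map_comp, NatTrans.comp_app]
  exact ConcreteCategory.congr_hom h2 e

/-- The structure map from `Ext²(R/Iⁿ, M)` to the local cohomology. -/
noncomputable def fromExt (I : Ideal R) (n : ℕ) (M : ModuleCat.{u} R) :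
    ((Ext R (ModuleCat.{u} R) 2).obj (Opposite.op (ModuleCat.of R (R ⧸ I ^ n)))).obj M ⟶
      (localCohomology I 2).obj M :=
  (colimit.ι (diagram (idealPowersDiagram I) 2) (Opposite.op (Opposite.op n))).app M

lemma fromExt_extMap (I : Ideal R) {n m : ℕ} (h : n ≤ m) (M : ModuleCat.{u} R) (e) :
    fromExt I m M (extMap (Ideal.pow_le_pow_right h) M e) = fromExt I n M e :=
  ConcreteCategory.congr_hom (congrArg (fun α => α.app M)
    (colimit.w (diagram (idealPowersDiagram I) 2) (homOfLE h).op.op)) e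

lemma exists_extMap_eq_zero (I : Ideal R) {n : ℕ} (M : ModuleCat.{u} R) (e)
    (he : fromExt I n M e = 0) :
    ∃ (m : ℕ) (h : n ≤ m), extMap (Ideal.pow_le_pow_right h) M e = 0 := by
  have := preservesSmallestFilteredColimits_of_preservesFilteredColimits
    (forget (ModuleCat.{u} R))
  have hc := isColimitOfPreserves ((evaluation _ _).obj M)
    (colimit.isColimit (diagram (idealPowersDiagram I) 2))
  obtain ⟨k, f, g, h⟩ := Concrete.isColimit_exists_of_rep_eq _ hc
    (i := Opposite.op (Opposite.op n)) (j := Opposite.op (Opposite.op n)) e 0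
    (he.trans (map_zero _).symm)
  exact ⟨k.unop.unop, leOfHom f.unop.unop, h.trans (map_zero _)⟩

variable {x y : R}

lemma span_pair_pow_le (x y : R) (t : ℕ) :
    Ideal.span {x, y} ^ (t + t) ≤ Ideal.span {x ^ t, y ^ t} := by
  rw [Ideal.span_insert, Ideal.span_insert,
    ← Ideal.span_singleton_pow, ← Ideal.span_singleton_pow]
  exact Ideal.sup_pow_add_le_pow_sup_pow

lemma span_pow_pair_le (x y : R) (t : ℕ) :
    Ideal.span {x ^ t, y ^ t} ≤ Ideal.span {x, y} ^ t := by
  rw [Ideal.span_le, Set.pair_subset_iff]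
  exact ⟨Ideal.pow_mem_pow (Ideal.subset_span (by simp)) t,
    Ideal.pow_mem_pow (Ideal.subset_span (by simp)) t⟩

lemma span_pow_pair_anti (x y : R) (t c : ℕ) :
    Ideal.span {x ^ t * x ^ c, y ^ t * y ^ c} ≤ Ideal.span {x ^ t, y ^ t} := by
  rw [Ideal.span_le, Set.pair_subset_iff]
  exact ⟨Ideal.mul_mem_right _ _ (Ideal.subset_span (by simp)),
    Ideal.mul_mem_right _ _ (Ideal.subset_span (by simp))⟩

/-- The map sending `m` to the class of `m / (xy)^t` in the second local cohomology. -/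
noncomputable def ofPow (hxy : ∀ t, Koszul.Regular (x ^ t) (y ^ t)) (M : ModuleCat.{u} R) (t : ℕ) :
    M →ₗ[R] (localCohomology (Ideal.span {x, y}) 2).obj M :=
  (fromExt _ (t + t) M).hom ∘ₗ (extMap (span_pair_pow_le x y t) M).hom ∘ₗ Koszul.toExt (hxy t) M

lemma ofPow_apply (hxy : ∀ t, Koszul.Regular (x ^ t) (y ^ t)) (M : ModuleCat.{u} R) (t : ℕ)
    (m : M) : ofPow hxy M t m =
      fromExt _ (t + t) M (extMap (span_pair_pow_le x y t) M (Koszul.toExt (hxy t) M m)) :=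
  rfl

lemma extMap_toExt (hxy : ∀ t, Koszul.Regular (x ^ t) (y ^ t)) (M : ModuleCat.{u} R) (t c : ℕ)
    (h : Ideal.span {x ^ (t + c), y ^ (t + c)} ≤ Ideal.span {x ^ t, y ^ t}) (m : M) :
    extMap h M (Koszul.toExt (hxy t) M m) =
      Koszul.toExt (hxy (t + c)) M ((x * y) ^ c • m) := by
  have key : ∀ (a b : R) (hab : Koszul.Regular a b)
      (h : Ideal.span {a, b} ≤ Ideal.span {x ^ t, y ^ t}),
      a = x ^ t * x ^ c → b = y ^ t * y ^ c →
      extMap h M (Koszul.toExt (hxy t) M m) = Koszul.toExt hab M ((x * y) ^ c • m) := by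
    rintro _ _ hab h rfl rfl
    rw [mul_pow]
    exact Koszul.toExt_naturality _ _ _ rfl _
  exact key _ _ _ _ (pow_add _ _ _) (pow_add _ _ _)

lemma ofPow_eq_ofPow_add (hxy : ∀ t, Koszul.Regular (x ^ t) (y ^ t)) (M : ModuleCat.{u} R)
    (t c : ℕ) (m : M) : ofPow hxy M t m = ofPow hxy M (t + c) ((x * y) ^ c • m) := by
  have h : Ideal.span {x ^ (t + c), y ^ (t + c)} ≤ Ideal.span {x ^ t, y ^ t} := by
    simpa only [pow_add] using span_pow_pair_anti x y t c
  rw [ofPow_apply, ofPow_apply, ← extMap_toExt hxy M t c h, extMap_extMap,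
    ← fromExt_extMap _ (show t + t ≤ (t + c) + (t + c) by lia), extMap_extMap]

lemma ofPow_eq_zero (hxy : ∀ t, Koszul.Regular (x ^ t) (y ^ t)) (M : ModuleCat.{u} R) (t : ℕ)
    {m : M} (p q : M) (hm : m = x ^ t • p + y ^ t • q) : ofPow hxy M t m = 0 := by
  rw [ofPow_apply, (Koszul.toExt_eq_zero_iff (hxy t) m).2 ⟨p, q, hm⟩, map_zero, map_zero]

lemma exists_of_ofPow_eq_zero (hxy : ∀ t, Koszul.Regular (x ^ t) (y ^ t)) (M : ModuleCat.{u} R)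
    {t : ℕ} {m : M} (hm : ofPow hxy M t m = 0) :
    ∃ (c : ℕ) (p q : M), (x * y) ^ c • m = x ^ (t + c) • p + y ^ (t + c) • q := by
  obtain ⟨s, hs, h⟩ := exists_extMap_eq_zero _ M _ hm
  obtain ⟨c, rfl⟩ := Nat.exists_eq_add_of_le (show t ≤ s by lia)
  refine ⟨c, (Koszul.toExt_eq_zero_iff (hxy (t + c)) _).1 ?_⟩
  have h' := congrArg (extMap (span_pow_pair_le x y (t + c)) M) h
  rw [extMap_extMap, map_zero] at h'
  erw [extMap_extMap] at h'
  rwa [extMap_toExt] at h'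

end localCohomology

end Koszul

namespace MvPolynomial

lemma regular_X_pow {T : Type*} [CommRing T] [IsDomain T] {σ : Type*} {i j : σ} (hij : i ≠ j)
    (t : ℕ) : Koszul.Regular ((X i : MvPolynomial σ T) ^ t) (X j ^ t) where
  eq_zero _ hr := (mul_eq_zero.mp hr).resolve_left (pow_ne_zero _ (X_ne_zero i))
  dvd _ hr := by
    refine (X_prime (i := i)).pow_dvd_of_dvd_mul_left t (fun h => ?_) hr
    have h' := (X_prime (i := i)).dvd_of_dvd_pow h
    rw [X_dvd_X] at h'
    simp_all

end MvPolynomial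

instance MvPowerSeries.instIsDomain {σ k : Type*} [CommRing k] [IsDomain k] :
    IsDomain (MvPowerSeries σ k) := NoZeroDivisors.to_isDomain _

namespace HartshorneExample

variable (k : Type*) [CommRing k]

/-- The ring `k[[u,v]][x,y]`, with `x = X 0`, `y = X 1`. -/
abbrev PolyRing := MvPolynomial (Fin 2) (MvPowerSeries (Fin 2) k)

/-- The power series variable `u`. -/
noncomputable def u : PolyRing k := C (MvPowerSeries.X 0)

/-- The power series variable `v`. -/
noncomputable def v : PolyRing k := C (MvPowerSeries.X 1)

/-- The hypersurface equation `ux + vy`. -/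
noncomputable def f : PolyRing k := u k * X 0 + v k * X 1

variable {k}

/-- The coefficient of `u ^ q * v ^ p * x ^ i * y ^ j`. -/
noncomputable def bicoeff (i j q p : ℕ) : PolyRing k →ₗ[k] k :=
  (MvPowerSeries.coeff (Finsupp.single 0 q + Finsupp.single 1 p)).comp
    ((lcoeff (MvPowerSeries (Fin 2) k)
      (Finsupp.single 0 i + Finsupp.single 1 j)).restrictScalars k)

lemma bicoeff_apply (i j q p : ℕ) (g : PolyRing k) : bicoeff i j q p g =
    MvPowerSeries.coeff (Finsupp.single 0 q + Finsupp.single 1 p)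
      (coeff (Finsupp.single 0 i + Finsupp.single 1 j) g) := rfl

lemma bicoeff_u_mul_X_mul (i j q p : ℕ) (g : PolyRing k) :
    bicoeff (i + 1) j (q + 1) p (u k * X 0 * g) = bicoeff i j q p g := by
  have h (n m : ℕ) : (Finsupp.single 0 (n + 1) + Finsupp.single 1 m : Fin 2 →₀ ℕ) =
      Finsupp.single 0 1 + (Finsupp.single 0 n + Finsupp.single 1 m) := by
    rw [← add_assoc, ← Finsupp.single_add, add_comm 1]
  simp only [bicoeff_apply]
  rw [u, mul_assoc, coeff_C_mul, h q, h i, coeff_X_mul, MvPowerSeries.X,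
    MvPowerSeries.coeff_add_monomial_mul, one_mul]

lemma bicoeff_u_mul (i j p : ℕ) (g : PolyRing k) : bicoeff i j 0 p (u k * g) = 0 := by
  rw [bicoeff_apply, u, coeff_C_mul, MvPowerSeries.X, MvPowerSeries.coeff_monomial_mul, if_neg]
  intro h
  simpa using h 0

lemma bicoeff_v_mul_X_mul (i j q p : ℕ) (g : PolyRing k) :
    bicoeff i (j + 1) q (p + 1) (v k * X 1 * g) = bicoeff i j q p g := by
  have h (n m : ℕ) : (Finsupp.single 0 m + Finsupp.single 1 (n + 1) : Fin 2 →₀ ℕ) =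
      Finsupp.single 1 1 + (Finsupp.single 0 m + Finsupp.single 1 n) := by
    rw [add_left_comm, ← Finsupp.single_add, add_comm 1]
  simp only [bicoeff_apply]
  rw [v, mul_assoc, coeff_C_mul, h p, h j, coeff_X_mul, MvPowerSeries.X,
    MvPowerSeries.coeff_add_monomial_mul, one_mul]

lemma bicoeff_v_mul (i j q : ℕ) (g : PolyRing k) : bicoeff i j q 0 (v k * g) = 0 := by
  rw [bicoeff_apply, v, coeff_C_mul, MvPowerSeries.X, MvPowerSeries.coeff_monomial_mul, if_neg]
  intro h
  simpa using h 1

lemma bicoeff_X_zero_pow_mul {i N : ℕ} (hi : i < N) (j q p : ℕ) (g : PolyRing k) :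
    bicoeff i j q p (X 0 ^ N * g) = 0 := by
  rw [bicoeff_apply, X_pow_eq_monomial, coeff_monomial_mul', if_neg, map_zero]
  intro h
  have := h 0
  simp at this
  lia

lemma bicoeff_X_one_pow_mul {j N : ℕ} (hj : j < N) (i q p : ℕ) (g : PolyRing k) :
    bicoeff i j q p (X 1 ^ N * g) = 0 := by
  rw [bicoeff_apply, X_pow_eq_monomial, coeff_monomial_mul', if_neg, map_zero]
  intro h
  have := h 1
  simp at this
  lia

lemma bicoeff_monomial (i j q p i' j' m : ℕ) :
    bicoeff i j q p (u k ^ m * (X 0 ^ i' * X 1 ^ j')) =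
      if i = i' ∧ j = j' ∧ q = m ∧ p = 0 then 1 else 0 := by
  have h (a b c d : ℕ) : (Finsupp.single 0 a + Finsupp.single 1 b : Fin 2 →₀ ℕ) =
      Finsupp.single 0 c + Finsupp.single 1 d ↔ a = c ∧ b = d := by
    refine ⟨fun h => ?_, by rintro ⟨rfl, rfl⟩; rfl⟩
    have h0 := DFunLike.congr_fun h 0
    have h1 := DFunLike.congr_fun h 1
    simp at h0 h1
    exact ⟨h0, h1⟩
  have h' : (Finsupp.single 0 m : Fin 2 →₀ ℕ) = Finsupp.single 0 m + Finsupp.single 1 0 := by simp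
  rw [bicoeff_apply, u, ← C_pow, coeff_C_mul, X_pow_eq_monomial, X_pow_eq_monomial,
    monomial_mul, coeff_monomial, MvPowerSeries.X_pow_eq, h', one_mul]
  classical
  by_cases h1 : i = i' ∧ j = j'
  · obtain ⟨rfl, rfl⟩ := h1
    rw [if_pos rfl, mul_one, MvPowerSeries.coeff_monomial]
    simp only [h, true_and]
  · rw [if_neg, if_neg, mul_zero, map_zero]
    · tauto
    · rw [h]
      tauto

/-- A functional that detects the class of `u ^ n * x ^ (M + n + 1) * y ^ (M + 1)` modulo
`x ^ (M + n + 2)`, `y ^ (M + n + 2)` and `ux + vy`. -/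
noncomputable def residue (n M : ℕ) : PolyRing k →ₗ[k] k :=
  ∑ p ∈ Finset.HasAntidiagonal.antidiagonal n,
    (-1 : k) ^ p.1 • bicoeff (M + p.2 + 1) (M + p.1 + 1) p.2 p.1

lemma residue_apply (n M : ℕ) (g : PolyRing k) : residue n M g =
    ∑ p ∈ Finset.HasAntidiagonal.antidiagonal n,
      (-1 : k) ^ p.1 * bicoeff (M + p.2 + 1) (M + p.1 + 1) p.2 p.1 g := by
  simp [residue]

lemma residue_X_zero_pow_mul (n M : ℕ) (g : PolyRing k) :
    residue n M (X 0 ^ (M + n + 2) * g) = 0 := by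
  rw [residue_apply]
  refine Finset.sum_eq_zero fun p hp => ?_
  have := Finset.HasAntidiagonal.mem_antidiagonal.mp hp
  rw [bicoeff_X_zero_pow_mul (by lia), mul_zero]

lemma residue_X_one_pow_mul (n M : ℕ) (g : PolyRing k) :
    residue n M (X 1 ^ (M + n + 2) * g) = 0 := by
  rw [residue_apply]
  refine Finset.sum_eq_zero fun p hp => ?_
  have := Finset.HasAntidiagonal.mem_antidiagonal.mp hp
  rw [bicoeff_X_one_pow_mul (by lia), mul_zero]

lemma residue_f_mul (n M : ℕ) (g : PolyRing k) : residue n M (f k * g) = 0 := by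
  simp only [residue_apply, f, add_mul, map_add]
  cases n with
  | zero =>
    simp only [Finset.Nat.antidiagonal_zero, Finset.sum_singleton, mul_assoc, bicoeff_u_mul,
      bicoeff_v_mul, mul_zero, add_zero]
  | succ n =>
    rw [Finset.Nat.sum_antidiagonal_succ', Finset.Nat.sum_antidiagonal_succ]
    simp only [bicoeff_u_mul_X_mul, bicoeff_v_mul_X_mul, ← add_assoc]
    simp only [mul_assoc (u k), mul_assoc (v k), bicoeff_u_mul, bicoeff_v_mul, mul_zero,
      zero_add, add_zero, ← Finset.sum_add_distrib]
    refine Finset.sum_eq_zero fun p _ => ?_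
    ring

lemma residue_monomial (n M m j : ℕ) :
    residue n M (u k ^ m * (X 0 ^ (M + n + 1) * X 1 ^ j)) =
      if n = m ∧ j = M + 1 then 1 else 0 := by
  rw [residue_apply, Finset.sum_eq_single (0, n)]
  · simp [bicoeff_monomial, and_comm, eq_comm]
  · rintro ⟨p, q⟩ hp hne
    rw [bicoeff_monomial, if_neg, mul_zero]
    have := Finset.HasAntidiagonal.mem_antidiagonal.mp hp
    rintro ⟨-, -, -, h⟩
    simp_all
  · simp

open localCohomology

section Socle

variable (k : Type u) [Field k]

/-- The module `R ⧸ (ux + vy)`. -/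
noncomputable abbrev hypersurface : ModuleCat.{u} (PolyRing k) :=
  ModuleCat.of (PolyRing k) (PolyRing k ⧸ Ideal.span {f k})

/-- The second local cohomology of `R ⧸ (ux + vy)` with support in `(x, y)`. -/
noncomputable abbrev cohomology : ModuleCat.{u} (PolyRing k) :=
  (localCohomology (Ideal.span {(X 0 : PolyRing k), X 1}) 2).obj (hypersurface k)

/-- The class in the local cohomology of the fraction `g / (xy) ^ t`. -/
noncomputable def fraction (t : ℕ) : PolyRing k →ₗ[PolyRing k] cohomology k :=
  (ofPow (regular_X_pow zero_ne_one) (hypersurface k) t).comp (Ideal.span {f k}).mkQ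

/-- The homogeneous maximal ideal `(u, v, x, y)`. -/
noncomputable abbrev maxIdeal : Ideal (PolyRing k) := Ideal.span {u k, v k, X 0, X 1}

/-- The class of `u ^ n * x ^ (n + 1) * y / (xy) ^ (n + 2)`. -/
noncomputable def socleElement (n : ℕ) : cohomology k :=
  fraction k (n + 2) (u k ^ n * (X 0 ^ (n + 1) * X 1))

variable {k}

lemma fraction_eq_fraction_add (t c : ℕ) (g : PolyRing k) :
    fraction k t g = fraction k (t + c) ((X 0 * X 1) ^ c * g) := by
  rw [fraction, LinearMap.comp_apply, ofPow_eq_ofPow_add _ _ t c, ← map_smul]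
  rfl

lemma fraction_eq_zero {t : ℕ} {g p q h : PolyRing k}
    (hg : g = X 0 ^ t * p + X 1 ^ t * q + f k * h) : fraction k t g = 0 := by
  refine ofPow_eq_zero _ (hypersurface k) t ((Ideal.span {f k}).mkQ p) ((Ideal.span {f k}).mkQ q) ?_
  rw [← map_smul, ← map_smul, ← map_add, ← sub_eq_zero, ← map_sub, Submodule.mkQ_apply,
    Submodule.Quotient.mk_eq_zero, Ideal.mem_span_singleton]
  exact ⟨h, by rw [hg, smul_eq_mul, smul_eq_mul]; ring⟩

lemma exists_of_fraction_eq_zero {t : ℕ} {g : PolyRing k} (hg : fraction k t g = 0) :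
    ∃ c p q h, (X 0 * X 1) ^ c * g = X 0 ^ (t + c) * p + X 1 ^ (t + c) * q + f k * h := by
  obtain ⟨c, p, q, hc⟩ := exists_of_ofPow_eq_zero (regular_X_pow zero_ne_one) (hypersurface k) hg
  obtain ⟨p, rfl⟩ := Submodule.mkQ_surjective _ p
  obtain ⟨q, rfl⟩ := Submodule.mkQ_surjective _ q
  rw [← map_smul, ← map_smul, ← map_smul, ← map_add, ← sub_eq_zero, ← map_sub, Submodule.mkQ_apply,
    Submodule.Quotient.mk_eq_zero, Ideal.mem_span_singleton] at hc
  obtain ⟨h, hh⟩ := hc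
  exact ⟨c, p, q, h, by simpa [sub_eq_iff_eq_add'] using hh⟩

lemma exists_u_mul_pow (n : ℕ) : ∃ h, (u k * X 0) ^ n = (-(v k) * X 1) ^ n + f k * h := by
  obtain ⟨h, hh⟩ := sub_dvd_pow_sub_pow (u k * X 0) (-(v k) * X 1) n
  exact ⟨h, by rw [f]; linear_combination hh⟩

lemma smul_socleElement (n : ℕ) {r : PolyRing k} (hr : r ∈ maxIdeal k) :
    r • socleElement k n = 0 := by
  suffices maxIdeal k ≤
      LinearMap.ker (LinearMap.toSpanSingleton (PolyRing k) _ (socleElement k n)) from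
    this hr
  rw [Ideal.span_le]
  rintro r (rfl | rfl | rfl | rfl) <;>
    rw [SetLike.mem_coe, LinearMap.mem_ker, LinearMap.toSpanSingleton_apply, socleElement,
      ← map_smul, smul_eq_mul]
  · obtain ⟨h, hh⟩ := exists_u_mul_pow (k := k) (n + 1)
    exact fraction_eq_zero (p := 0) (q := (-(v k)) ^ (n + 1)) (h := X 1 * h)
      (by linear_combination X 1 * hh)
  · exact fraction_eq_zero (p := -u k ^ (n + 1)) (q := 0) (h := u k ^ n * X 0 ^ (n + 1))
      (by rw [f]; ring)
  · exact fraction_eq_zero (p := u k ^ n * X 1) (q := 0) (h := 0) (by ring)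
  · obtain ⟨h, hh⟩ := exists_u_mul_pow (k := k) n
    exact fraction_eq_zero (p := 0) (q := X 0 * (-(v k)) ^ n) (h := X 0 * X 1 ^ 2 * h)
      (by linear_combination X 0 * X 1 ^ 2 * hh)

lemma socleElement_eq_fraction {n B : ℕ} (h : n ≤ B) : socleElement k n =
    fraction k (B + 2) (u k ^ n * (X 0 ^ (B + 1) * X 1 ^ (B - n + 1))) := by
  obtain ⟨c, rfl⟩ := Nat.exists_eq_add_of_le h
  rw [socleElement, fraction_eq_fraction_add (n + 2) c, add_right_comm n 2 c,
    Nat.add_sub_cancel_left]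
  refine congrArg (fraction k _) ?_
  ring

lemma eq_zero_of_sum_socleElement_eq_zero {s : Finset ℕ} {a : ℕ → k}
    (ha : ∑ m ∈ s, algebraMap k (PolyRing k) (a m) • socleElement k m = 0) {n : ℕ} (hn : n ∈ s) :
    a n = 0 := by
  obtain ⟨B, hB⟩ : ∃ B, ∀ m ∈ s, m ≤ B := ⟨s.sup id, fun m hm => Finset.le_sup (f := id) hm⟩
  have hs : fraction k (B + 2) (∑ m ∈ s, a m • (u k ^ m * (X 0 ^ (B + 1) * X 1 ^ (B - m + 1)))) =
      0 := by
    rw [← ha, map_sum]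
    refine Finset.sum_congr rfl fun m hm => ?_
    rw [socleElement_eq_fraction (hB m hm), ← map_smul, algebraMap_smul]
  obtain ⟨c, p, q, h, hc⟩ := exists_of_fraction_eq_zero hs
  obtain ⟨d, rfl⟩ := Nat.exists_eq_add_of_le (hB n hn)
  have hr := congrArg (residue n (d + c)) hc
  rw [show n + d + 2 + c = d + c + n + 2 by ring, map_add, map_add, residue_X_zero_pow_mul,
    residue_X_one_pow_mul, residue_f_mul, Finset.mul_sum, map_sum,
    Finset.sum_eq_single_of_mem n hn] at hr
  · rw [mul_smul_comm, map_smul, Nat.add_sub_cancel_left,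
      show (X 0 * X 1 : PolyRing k) ^ c * (u k ^ n * (X 0 ^ (n + d + 1) * X 1 ^ (d + 1))) =
        u k ^ n * (X 0 ^ (d + c + n + 1) * X 1 ^ (d + c + 1)) by ring, residue_monomial] at hr
    simpa using hr
  · intro m _ hm
    rw [mul_smul_comm, map_smul,
      show (X 0 * X 1 : PolyRing k) ^ c * (u k ^ m * (X 0 ^ (n + d + 1) * X 1 ^ (n + d - m + 1))) =
        u k ^ m * (X 0 ^ (d + c + n + 1) * X 1 ^ (n + d - m + 1 + c)) by ring, residue_monomial,
      if_neg (by tauto), smul_zero]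

lemma exists_eq_C_add (g : MvPowerSeries (Fin 2) k) : ∃ (a : k) (p q : MvPowerSeries (Fin 2) k),
    g = MvPowerSeries.C a + MvPowerSeries.X 0 * p + MvPowerSeries.X 1 * q := by
  let h : MvPowerSeries (Fin 2) k := fun m =>
    if m 0 = 0 then MvPowerSeries.coeff m (g - MvPowerSeries.C g.constantCoeff) else 0
  have hh (m) : MvPowerSeries.coeff m h =
    if m 0 = 0 then MvPowerSeries.coeff m (g - MvPowerSeries.C g.constantCoeff) else 0 := rfl
  obtain ⟨p, hp⟩ : MvPowerSeries.X 0 ∣ g - MvPowerSeries.C g.constantCoeff - h := by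
    rw [MvPowerSeries.X_dvd_iff]
    intro m hm
    rw [map_sub, hh, if_pos hm, sub_self]
  obtain ⟨q, hq⟩ : MvPowerSeries.X 1 ∣ h := by
    rw [MvPowerSeries.X_dvd_iff]
    intro m hm
    rw [hh]
    split_ifs with hm'
    · obtain rfl : m = 0 := by
        ext i
        fin_cases i <;> simpa
      simp
    · rfl
  exact ⟨g.constantCoeff, p, q, by linear_combination hp + hq⟩

lemma exists_sub_algebraMap_mem (r : PolyRing k) : ∃ a : k, r - algebraMap k _ a ∈ maxIdeal k := by
  have hT (g : MvPowerSeries (Fin 2) k) : ∃ a : k, C g - algebraMap k _ a ∈ maxIdeal k := by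
    obtain ⟨a, p, q, h⟩ := exists_eq_C_add g
    refine ⟨a, ?_⟩
    rw [h, C_add, C_add, C_mul, C_mul, IsScalarTower.algebraMap_apply k (MvPowerSeries (Fin 2) k),
      algebraMap_eq, MvPowerSeries.algebraMap_apply, Algebra.algebraMap_self_apply, add_assoc,
      add_sub_cancel_left]
    exact add_mem (Ideal.mul_mem_right _ _ (Ideal.subset_span (by simp [u])))
      (Ideal.mul_mem_right _ _ (Ideal.subset_span (by simp [v])))
  have hC (r : PolyRing k) : ∃ g, r - C g ∈ maxIdeal k := by
    induction r using MvPolynomial.induction_on with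
    | C g => exact ⟨g, by simp⟩
    | add p q hp hq =>
      obtain ⟨a, ha⟩ := hp
      obtain ⟨b, hb⟩ := hq
      exact ⟨a + b, by rw [C_add, add_sub_add_comm]; exact add_mem ha hb⟩
    | mul_X p i _ =>
      refine ⟨0, ?_⟩
      rw [C_0, sub_zero]
      refine Ideal.mul_mem_left _ _ (Ideal.subset_span ?_)
      fin_cases i <;> simp
  obtain ⟨g, hg⟩ := hC r
  obtain ⟨a, ha⟩ := hT g
  exact ⟨a, by simpa using add_mem hg ha⟩

variable (k)

/-- The `R`-module `Hom_R(R/P, H²_I(R/fR))`. -/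
abbrev socleHom := (PolyRing k ⧸ maxIdeal k) →ₗ[PolyRing k] cohomology k

/-- The action of `k` on `Hom_R(R/P, H²_I(R/fR))` through `k → R`. -/
noncomputable abbrev socleHomModule : Module k (socleHom k) :=
  Module.compHom _ (algebraMap k (PolyRing k))

attribute [local instance] socleHomModule

lemma algebraMap_smul_socleHom (a : k) (φ : socleHom k) :
    a • φ = algebraMap k (PolyRing k) a • φ := rfl

/-- The homomorphism `R ⧸ P → H²_I(R/fR)` sending `1` to `socleElement k n`. -/
noncomputable def socleMap (n : ℕ) : socleHom k :=
  Submodule.liftQ _ (LinearMap.toSpanSingleton (PolyRing k) _ (socleElement k n))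
    fun _ hr => smul_socleElement n hr

lemma socleMap_one (n : ℕ) : socleMap k n 1 = socleElement k n :=
  (Submodule.liftQ_apply _ _ (1 : PolyRing k)).trans (one_smul _ _)

lemma linearIndependent_socleMap : LinearIndependent k (socleMap k) := by
  rw [linearIndependent_iff']
  intro s a ha n hn
  refine eq_zero_of_sum_socleElement_eq_zero (s := s) ?_ hn
  have h := LinearMap.congr_fun ha 1
  simpa [algebraMap_smul_socleHom, LinearMap.sum_apply, socleMap_one] using h

theorem not_finite_field : ¬ Module.Finite k (socleHom k) := fun _ =>
  not_finite_iff_infinite.mpr inferInstance (linearIndependent_socleMap k).finite_of_isNoetherian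

variable {k} in
lemma smul_eq_zero_of_mem {r : PolyRing k} (hr : r ∈ maxIdeal k) (φ : socleHom k) : r • φ = 0 := by
  refine LinearMap.ext fun z => ?_
  obtain ⟨z, rfl⟩ := Ideal.Quotient.mk_surjective z
  rw [LinearMap.smul_apply, ← map_smul, LinearMap.zero_apply]
  refine (congrArg φ ?_).trans (map_zero φ)
  exact Ideal.Quotient.eq_zero_iff_mem.mpr (Ideal.mul_mem_right _ _ hr)

theorem not_finite_ring : ¬ Module.Finite (PolyRing k) (socleHom k) := by
  rintro ⟨s, hs⟩
  refine not_finite_field k ⟨s, eq_top_iff.mpr fun φ _ => ?_⟩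
  have hφ : φ ∈ Submodule.span (PolyRing k) (s : Set (socleHom k)) := hs ▸ Submodule.mem_top
  induction hφ using Submodule.span_induction with
  | mem x hx => exact Submodule.subset_span hx
  | zero => exact zero_mem _
  | add x y _ _ hx hy => exact add_mem (hx trivial) (hy trivial)
  | smul r x _ hx =>
    obtain ⟨a, ha⟩ := exists_sub_algebraMap_mem r
    have h := smul_eq_zero_of_mem ha x
    rw [sub_smul, sub_eq_zero] at h
    rw [h, ← algebraMap_smul_socleHom]
    exact Submodule.smul_mem _ _ (hx trivial)

end Socle

end HartshorneExample

/-- **Hartshorne's example.**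
Let `k` be a field, `R = k[[u,v]][x,y]`, `I = (x,y)R`, `P = (u,v,x,y)R`, and
`f = ux + vy`.  Then `Hom_R(R/P, H²_I(R/fR))` is an infinite dimensional `k`-vector
space (the `k`-action being via `k → R`); in particular it is not a finitely
generated `R`-module. -/
theorem hartshorne_example_infinite_socle
    (k : Type) [Field k] :
    letI T := MvPowerSeries (Fin 2) k
    letI R := MvPolynomial (Fin 2) T
    letI u : T := MvPowerSeries.X 0
    letI v : T := MvPowerSeries.X 1
    letI I : Ideal R := Ideal.span {X 0, X 1}
    letI P : Ideal R := Ideal.span {MvPolynomial.C u, MvPolynomial.C v, X 0, X 1}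
    letI f : R := MvPolynomial.C u * X 0 + MvPolynomial.C v * X 1
    letI H := (R ⧸ P) →ₗ[R]
        ((localCohomology I 2).obj (ModuleCat.of R (R ⧸ Ideal.span {f})))
    ¬ (@Module.Finite k H _ _ (Module.compHom H (algebraMap k R)))
      ∧ ¬ Module.Finite R H := by
  exact ⟨HartshorneExample.not_finite_field k, HartshorneExample.not_finite_ring k⟩
end
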